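/- Let K, Q ∈ ℂ^{D×d} with K†K = 1_d, Q†Q = 1_d and K†QR = 0, let A ∈ ℂ^{d×d} be skew-Hermitian, and let R ∈ ℂ^{d×d}. Define K_t = (K Q) exp(t S)(1_d; 0) with S = [[A, −R†],[R, 0]], and let K̇_t denote its derivative in t. Then K_t† K̇_t = A for all t ∈ ℝ; in particular, along the curve the quantity K_t†K̇_t is constant and skew-Hermitian. -/

import Mathlib

open Matrix

/-- The curve `K_t = (K Q) exp(t [[A, −Rᴴ],[R, 0]]) (1; 0)` on the
complex Stiefel manifold. -/
noncomputable def stiefelGeodesic {D d : ℕ} (K Q : Matrix (Fin D) (Fin d) ℂ)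
    (A R : Matrix (Fin d) (Fin d) ℂ) (t : ℝ) : Matrix (Fin D) (Fin d) ℂ :=
  fromCols K Q *
    NormedSpace.exp (t • fromBlocks A (-Rᴴ) R 0) *
    fromRows (1 : Matrix (Fin d) (Fin d) ℂ) 0

section MatrixExp

variable {n : Type*} [Fintype n] [DecidableEq n]

attribute [local instance] Matrix.linftyOpNormedRing Matrix.linftyOpNormedAlgebra

theorem Matrix.hasDerivAt_exp_smul_apply (S : Matrix n n ℂ) (t : ℝ) (i j : n) :
    HasDerivAt (fun s : ℝ => NormedSpace.exp (s • S) i j)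
      ((S * NormedSpace.exp (t • S)) i j) t := by
  have h : HasDerivAt (fun s : ℝ => NormedSpace.exp (s • S)) (S * NormedSpace.exp (t • S)) t :=
    hasDerivAt_exp_smul_const' (𝕂 := ℝ) S t
  exact (Matrix.entryLinearMap ℝ ℂ i j).toContinuousLinearMap.hasFDerivAt.comp_hasDerivAt t h

/-- Left multiplication by a left annihilator of `S` does not see `exp S`. -/
theorem Matrix.mul_exp_of_mul_eq_zero {N S : Matrix n n ℂ} (h : N * S = 0) :
    N * NormedSpace.exp S = N := by
  have hs : SemiconjBy N S 0 := by simp [SemiconjBy, h]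
  have h' := SemiconjBy.exp_right hs
  rw [NormedSpace.exp_zero] at h'
  exact h'.eq.trans (Matrix.one_mul N)

theorem Matrix.commute_exp_smul (S : Matrix n n ℂ) (t : ℝ) :
    Commute S (NormedSpace.exp (t • S)) :=
  SemiconjBy.exp_right ((Commute.refl S).smul_right t)

end MatrixExp

theorem Matrix.conjTranspose_exp_smul_mul_mul_exp_smul {n : Type*} [Fintype n] [DecidableEq n]
    {S : Matrix n n ℂ} (h : Sᴴ = -S) (t : ℝ) :
    (NormedSpace.exp (t • S))ᴴ * (S * NormedSpace.exp (t • S)) = S := by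
  have hinv : (NormedSpace.exp (t • S))ᴴ = (NormedSpace.exp (t • S))⁻¹ := by
    rw [← Matrix.exp_conjTranspose, ← Matrix.exp_neg, conjTranspose_smul, h, star_trivial,
      smul_neg]
  have hdet := (isUnit_iff_isUnit_det _).mp (Matrix.isUnit_exp (t • S))
  rw [hinv, (commute_exp_smul S t).eq, ← Matrix.mul_assoc, nonsing_inv_mul _ hdet,
    Matrix.one_mul]

theorem Matrix.hasDerivAt_mul_mul_apply {l m n p : Type*} [Fintype m] [Fintype n]
    (B : Matrix l m ℂ) (C : Matrix n p ℂ) {F : ℝ → Matrix m n ℂ} {F' : Matrix m n ℂ} {t : ℝ}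
    (hF : ∀ i j, HasDerivAt (fun s => F s i j) (F' i j) t) (i : l) (j : p) :
    HasDerivAt (fun s => (B * F s * C) i j) ((B * F' * C) i j) t := by
  simp only [Matrix.mul_apply]
  exact HasDerivAt.fun_sum fun b _ =>
    (HasDerivAt.fun_sum fun a _ => (hF a b).const_mul (B i a)).mul_const (C b j)

/-- with `K̇_t` the derivative of the curve
`K_t = (K Q) exp(t S)(1; 0)` (expressed entrywise via `HasDerivAt`),
one has `K_tᴴ K̇_t = A` for all `t`; in particular, along the curve the
quantity `K_tᴴK̇_t` is constant and skew-Hermitian. -/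
theorem stiefel_geodesic_KdaggerKdot {D d : ℕ}
    (K Q : Matrix (Fin D) (Fin d) ℂ) (A R : Matrix (Fin d) (Fin d) ℂ)
    (hK : Kᴴ * K = 1) (hQ : Qᴴ * Q = 1) (hKQR : Kᴴ * Q * R = 0)
    (hA : Aᴴ = -A)
    (K' : ℝ → Matrix (Fin D) (Fin d) ℂ)
    (hK' : ∀ (t : ℝ) (i : Fin D) (j : Fin d),
      HasDerivAt (fun s : ℝ => stiefelGeodesic K Q A R s i j) (K' t i j) t) :
    ∀ t : ℝ, (stiefelGeodesic K Q A R t)ᴴ * K' t = A := by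
  intro t
  set S : Matrix (Fin d ⊕ Fin d) (Fin d ⊕ Fin d) ℂ := fromBlocks A (-Rᴴ) R 0 with hS
  set E := NormedSpace.exp (t • S)
  set e : Matrix (Fin d ⊕ Fin d) (Fin d) ℂ := fromRows 1 0 with he
  set N : Matrix (Fin d ⊕ Fin d) (Fin d ⊕ Fin d) ℂ := fromBlocks 0 (Kᴴ * Q) 0 0 with hN
  have hK't : K' t = fromCols K Q * (S * E) * e := by
    ext i j
    exact (hK' t i j).unique
      (hasDerivAt_mul_mul_apply _ _ (hasDerivAt_exp_smul_apply S t) i j)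
  have hcurve : stiefelGeodesic K Q A R t = fromCols K Q * E * e := rfl
  have hSH : Sᴴ = -S := by
    simp [hS, fromBlocks_conjTranspose, fromBlocks_neg, hA]
  have hEH : Eᴴ * (S * E) = S := conjTranspose_exp_smul_mul_mul_exp_smul hSH t
  have hNS : N * S = 0 := by
    simp [hN, hS, fromBlocks_multiply, hKQR]
  have hNE : N * E = N := mul_exp_of_mul_eq_zero (by rw [Matrix.mul_smul, hNS, smul_zero])
  have hNe : N * e = 0 := by
    simp [hN, he, fromBlocks_mul_fromRows]
  have hleft : eᴴ * Eᴴ * Nᴴ = 0 := by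
    rw [← conjTranspose_mul, ← conjTranspose_mul, ← Matrix.mul_assoc, hNE, hNe,
      conjTranspose_zero]
  have hGram : (fromCols K Q)ᴴ * fromCols K Q = 1 + N + Nᴴ := by
    rw [conjTranspose_fromCols_eq_fromRows_conjTranspose, fromRows_mul_fromCols, hK, hQ,
      hN, fromBlocks_conjTranspose, ← fromBlocks_one, fromBlocks_add, fromBlocks_add]
    simp
  have heSe : eᴴ * S * e = A := by
    simp [he, hS, conjTranspose_fromRows_eq_fromCols_conjTranspose, fromCols_mul_fromBlocks,
      fromCols_mul_fromRows]
  calc (stiefelGeodesic K Q A R t)ᴴ * K' t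
      = eᴴ * Eᴴ * ((fromCols K Q)ᴴ * fromCols K Q) * (S * E) * e := by
        rw [hK't, hcurve, conjTranspose_mul, conjTranspose_mul]
        simp only [Matrix.mul_assoc]
    _ = eᴴ * (Eᴴ * (S * E)) * e + eᴴ * Eᴴ * (N * S) * E * e
          + (eᴴ * Eᴴ * Nᴴ) * (S * E) * e := by
        rw [hGram]
        simp only [Matrix.mul_add, Matrix.add_mul, Matrix.mul_one, Matrix.mul_assoc]
    _ = A := by
        rw [hEH, hNS, hleft, heSe]
        simp
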